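/- For every prime p \ge 7, writing H(-)=H(-;p-1), one has H(1,-3) \equiv \frac{1}{2} H(-2,2) \equiv \sum_{k=0}^{p-3} 2^k B_k B_{p-3-k} \pmod{p} and H(-1,3) \equiv -\frac{1}{2} q_p B_{p-3} \pmod{p}. -/

import Mathlib

open Finset

/-- sign of an integer as a rational: `-1` if negative, else `1`. -/
def sgn (s : ℤ) : ℚ := if s < 0 then -1 else 1

/-- Auxiliary: alternating multiple harmonic sum with the index list reversed
    (head of the list corresponds to the outermost, i.e. largest, summation index). -/
def Hrev : List ℤ → ℕ → ℚ
  | [], _ => 1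
  | s :: t, n => ∑ k ∈ Finset.Icc 1 n, (sgn s) ^ k / (k : ℚ) ^ s.natAbs * Hrev t (k - 1)

/-- The alternating multiple harmonic sum `H(s₁,…,s_d; n)`:
    the sum over `1 ≤ k₁ < ⋯ < k_d ≤ n` of `∏ sign(sᵢ)^{kᵢ}/kᵢ^{|sᵢ|}`. -/
def H (s : List ℤ) (n : ℕ) : ℚ := Hrev s.reverse n

/-- Auxiliary for the non-strict version. -/
def Srev : List ℤ → ℕ → ℚ
  | [], _ => 1
  | s :: t, n => ∑ k ∈ Finset.Icc 1 n, (sgn s) ^ k / (k : ℚ) ^ s.natAbs * Srev t k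

/-- The non-strict alternating multiple harmonic sum `S(s₁,…,s_d; n)`:
    the sum over `1 ≤ k₁ ≤ ⋯ ≤ k_d ≤ n`. -/
def S (s : List ℤ) (n : ℕ) : ℚ := Srev s.reverse n

/-- `x ≡ y (mod m)` for rationals: the numerator of `x - y` in lowest terms is
    divisible by `m`. -/
def pcong (m : ℕ) (x y : ℚ) : Prop := (m : ℤ) ∣ (x - y).num

/-- The Fermat quotient of 2 : `q_p = (2^{p-1}-1)/p`. -/
def qp (p : ℕ) : ℚ := (2 ^ (p - 1) - 1) / p

/-- `s ⊕ t = sign(st)(|s|+|t|)`, with the convention that `0 ⊕ t = t` and `s ⊕ 0 = s`. -/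
def oplus (s t : ℤ) : ℤ :=
  if s = 0 then t else if t = 0 then s else (s * t).sign * (|s| + |t|)

/-! ### Reduction of `p`-integral rationals modulo `p` -/

/-- `x : ZMod p` is the reduction modulo `p` of the `p`-integral rational `q`. -/
def ReducesTo (p : ℕ) (q : ℚ) (x : ZMod p) : Prop :=
  ∃ a b : ℤ, (b : ZMod p) ≠ 0 ∧ q = a / b ∧ x * b = a

namespace ReducesTo

theorem int_ne_zero {p : ℕ} {b : ℤ} (hb : (b : ZMod p) ≠ 0) : (b : ℚ) ≠ 0 := by
  rintro h
  apply hb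
  rw [Int.cast_eq_zero] at h
  simp [h]

variable {p : ℕ} [Fact p.Prime] {q r : ℚ} {x y : ZMod p}

theorem intCast (n : ℤ) : ReducesTo p n n := ⟨n, 1, by simp, by simp, by simp⟩

theorem natCast (n : ℕ) : ReducesTo p n n := by simpa using intCast (p := p) (n : ℤ)

theorem zero : ReducesTo p 0 0 := by simpa using natCast (p := p) 0

theorem one : ReducesTo p 1 1 := by simpa using natCast (p := p) 1

theorem ofNat (n : ℕ) [n.AtLeastTwo] : ReducesTo p (OfNat.ofNat n) (OfNat.ofNat n) :=
  natCast (p := p) n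

theorem add (hq : ReducesTo p q x) (hr : ReducesTo p r y) : ReducesTo p (q + r) (x + y) := by
  obtain ⟨a, b, hb, rfl, hx⟩ := hq
  obtain ⟨c, d, hd, rfl, hy⟩ := hr
  have hb' := int_ne_zero hb
  have hd' := int_ne_zero hd
  refine ⟨a * d + b * c, b * d, by push_cast; exact mul_ne_zero hb hd, ?_, ?_⟩
  · push_cast
    field_simp
  · push_cast
    linear_combination (d : ZMod p) * hx + (b : ZMod p) * hy

theorem mul (hq : ReducesTo p q x) (hr : ReducesTo p r y) : ReducesTo p (q * r) (x * y) := by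
  obtain ⟨a, b, hb, rfl, hx⟩ := hq
  obtain ⟨c, d, hd, rfl, hy⟩ := hr
  have hb' := int_ne_zero hb
  have hd' := int_ne_zero hd
  refine ⟨a * c, b * d, by push_cast; exact mul_ne_zero hb hd, ?_, ?_⟩
  · push_cast
    field_simp
  · push_cast
    linear_combination (y * d) * hx + (a : ZMod p) * hy

theorem neg (hq : ReducesTo p q x) : ReducesTo p (-q) (-x) := by
  simpa using (intCast (p := p) (-1)).mul hq

theorem sub (hq : ReducesTo p q x) (hr : ReducesTo p r y) : ReducesTo p (q - r) (x - y) := by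
  simpa [sub_eq_add_neg] using hq.add hr.neg

theorem pow (hq : ReducesTo p q x) (n : ℕ) : ReducesTo p (q ^ n) (x ^ n) := by
  induction n with
  | zero => simpa using one
  | succ n ih => simpa [pow_succ] using ih.mul hq

theorem inv (hq : ReducesTo p q x) (hx : x ≠ 0) : ReducesTo p q⁻¹ x⁻¹ := by
  obtain ⟨a, b, hb, rfl, h⟩ := hq
  refine ⟨b, a, by rw [← h]; exact mul_ne_zero hx hb, by simp, ?_⟩
  rw [← h, inv_mul_cancel_left₀ hx]

theorem div (hq : ReducesTo p q x) (hr : ReducesTo p r y) (hy : y ≠ 0) :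
    ReducesTo p (q / r) (x / y) := by
  simpa [div_eq_mul_inv] using hq.mul (hr.inv hy)

theorem sum {ι : Type*} {s : Finset ι} {f : ι → ℚ} {g : ι → ZMod p}
    (h : ∀ i ∈ s, ReducesTo p (f i) (g i)) : ReducesTo p (∑ i ∈ s, f i) (∑ i ∈ s, g i) := by
  classical
  induction s using Finset.induction_on with
  | empty => simpa using zero
  | insert a s ha ih =>
    rw [Finset.sum_insert ha, Finset.sum_insert ha]
    exact (h a (by simp)).add (ih fun i hi => h i (by simp [hi]))

theorem cast_eq (hq : ReducesTo p q x) : (q : ZMod p) = x := by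
  obtain ⟨a, b, hb, rfl, hx⟩ := hq
  rw [← Rat.divInt_eq_div, Rat.cast_divInt_of_ne_zero _ hb, ← hx, mul_div_cancel_right₀ _ hb]

theorem unique (hq : ReducesTo p q x) (hr : ReducesTo p q y) : x = y :=
  hq.cast_eq.symm.trans hr.cast_eq

theorem pcong (hq : ReducesTo p q x) (hr : ReducesTo p r x) : pcong p q r := by
  obtain ⟨a, b, hb, h, h0⟩ := hq.sub hr
  have hb' := int_ne_zero hb
  have ha : (p : ℤ) ∣ a := by
    rw [← ZMod.intCast_zmod_eq_zero_iff_dvd, ← h0]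
    simp
  have key : (q - r).num * b = a * (q - r).den := by
    have h1 : ((q - r).num : ℚ) / (q - r).den = a / b := by rw [Rat.num_div_den, h]
    have hd : ((q - r).den : ℚ) ≠ 0 := by exact_mod_cast (q - r).den_nz
    rw [div_eq_div_iff hd hb'] at h1
    exact_mod_cast h1
  have h2 : (p : ℤ) ∣ (q - r).num * b := key ▸ Dvd.dvd.mul_right ha _
  refine (Int.Prime.dvd_mul' Fact.out h2).resolve_right fun h3 => hb ?_
  rwa [ZMod.intCast_zmod_eq_zero_iff_dvd]

end ReducesTo

section Modular

variable {p : ℕ} [Fact p.Prime]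

theorem natCast_ne_zero_of_mem_Ico {k : ℕ} (hk : k ∈ Ico 1 p) : (k : ZMod p) ≠ 0 := by
  rw [mem_Ico] at hk
  rw [Ne, ZMod.natCast_eq_zero_iff]
  exact Nat.not_dvd_of_pos_of_lt hk.1 hk.2

/-! ### Bernoulli numbers modulo `p` -/

variable (p) in
/-- The reduction modulo `p` of the `k`-th Bernoulli number (meaningful for `k ≤ p - 2`). -/
def bern (k : ℕ) : ZMod p := ((bernoulli k : ℚ) : ZMod p)

theorem reducesTo_bernoulli {n : ℕ} (hn : n + 1 < p) :
    ReducesTo p (bernoulli n) (bern p n) := by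
  suffices h : ∃ x, ReducesTo p (bernoulli n) x by
    obtain ⟨x, hx⟩ := h
    rwa [bern, hx.cast_eq]
  induction n using Nat.strong_induction_on with
  | _ n ih =>
    choose! g hg using fun k (hk : k ∈ range n) =>
      ih k (mem_range.1 hk) (by have := mem_range.1 hk; omega)
    have hs := sum_bernoulli (n + 1)
    rw [sum_range_succ, Nat.choose_succ_self_right] at hs
    have hne : ((n + 1 : ℕ) : ZMod p) ≠ 0 :=
      natCast_ne_zero_of_mem_Ico (mem_Ico.2 ⟨by omega, hn⟩)
    have hq : bernoulli n = ((((if n + 1 = 1 then 1 else 0 : ℕ) : ℚ))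
        - ∑ k ∈ range n, ((n + 1).choose k : ℚ) * bernoulli k) / ((n + 1 : ℕ) : ℚ) := by
      have : ((n + 1 : ℕ) : ℚ) ≠ 0 := by positivity
      rw [eq_div_iff this]
      push_cast at hs ⊢
      linear_combination hs
    rw [hq]
    exact ⟨_, ((ReducesTo.natCast _).sub (ReducesTo.sum fun k hk =>
      (ReducesTo.natCast _).mul (hg k hk))).div (ReducesTo.natCast _) hne⟩

theorem bern_eq_zero_of_odd {k : ℕ} (hk : Odd k) (h1 : 1 < k) : bern p k = 0 := by
  simp [bern, bernoulli_eq_zero_of_odd hk h1]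

theorem sum_range_pow_eq_bern {m : ℕ} (hm : m + 1 < p) (n : ℕ) :
    ∑ k ∈ range n, (k : ZMod p) ^ m =
      ∑ i ∈ range (m + 1),
        bern p i * ((m + 1).choose i) * (n : ZMod p) ^ (m + 1 - i) / ((m + 1 : ℕ) : ZMod p) := by
  have h1 : ReducesTo p (∑ k ∈ range n, (k : ℚ) ^ m) (∑ k ∈ range n, (k : ZMod p) ^ m) :=
    ReducesTo.sum fun k _ => (ReducesTo.natCast k).pow m
  rw [sum_range_pow] at h1
  refine h1.unique (ReducesTo.sum fun i hi => ?_)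
  have hi := mem_range.1 hi
  have h2 := ((reducesTo_bernoulli (p := p) (n := i) (by omega)).mul
    (ReducesTo.natCast ((m + 1).choose i))).mul ((ReducesTo.natCast n).pow (m + 1 - i))
  have h3 := h2.div (ReducesTo.natCast (m + 1))
    (natCast_ne_zero_of_mem_Ico (mem_Ico.2 ⟨by omega, hm⟩))
  exact_mod_cast h3

end Modular

theorem sum_bernoulli_mul_two_pow (n : ℕ) :
    ∑ i ∈ range (n + 1), bernoulli i * n.choose i * 2 ^ i = (2 - 2 ^ n) * bernoulli n := by
  have h := bernoulliFun_eval_half n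
  rw [bernoulliFun, Polynomial.bernoulli, Polynomial.eval_map, Polynomial.eval₂_finsetSum] at h
  simp only [Polynomial.eval₂_monomial, eq_ratCast] at h
  have h2 : ∀ i ∈ range (n + 1), ((bernoulli i * n.choose i * 2 ^ i : ℚ) : ℝ) =
      2 ^ n * (((bernoulli i * n.choose i : ℚ) : ℝ) * 2⁻¹ ^ (n - i)) := by
    intro i hi
    have hi : i ≤ n := by simpa [Nat.lt_succ_iff] using hi
    obtain ⟨k, rfl⟩ := Nat.exists_eq_add_of_le hi
    rw [Nat.add_sub_cancel_left, pow_add, inv_pow]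
    push_cast
    field_simp
  have : ((∑ i ∈ range (n + 1), bernoulli i * n.choose i * 2 ^ i : ℚ) : ℝ)
      = (((2 - 2 ^ n) * bernoulli n : ℚ) : ℝ) := by
    rw [Rat.cast_sum, sum_congr rfl h2, ← mul_sum, h]
    push_cast
    field_simp
  exact_mod_cast this

section Modular

variable {p : ℕ}

/-! ### Depth one and depth two sums over a field of `p` elements -/

/-- The depth one sum `∑_{1 ≤ j < p} f j`. -/
def sum₁ (p : ℕ) (f : ℕ → ZMod p) : ZMod p := ∑ j ∈ Ico 1 p, f j

/-- The depth two sum `∑_{1 ≤ i < j < p} f i * g j`. -/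
def sum₂ (p : ℕ) (f g : ℕ → ZMod p) : ZMod p := ∑ j ∈ Ico 1 p, (∑ i ∈ Ico 1 j, f i) * g j

/-- The summand `1 / i ^ a` modulo `p`. -/
def invPow (p a i : ℕ) : ZMod p := ((i : ZMod p)⁻¹) ^ a

/-- The summand `(-1) ^ i / i ^ a` modulo `p`. -/
def altInvPow (p a i : ℕ) : ZMod p := (-1) ^ i * ((i : ZMod p)⁻¹) ^ a

theorem sum₁_congr {f g : ℕ → ZMod p} (h : ∀ i ∈ Ico 1 p, f i = g i) : sum₁ p f = sum₁ p g :=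
  sum_congr rfl h

theorem sum₂_congr {f f' g g' : ℕ → ZMod p} (hf : ∀ i ∈ Ico 1 p, f i = f' i)
    (hg : ∀ i ∈ Ico 1 p, g i = g' i) : sum₂ p f g = sum₂ p f' g' := by
  refine sum_congr rfl fun j hj => ?_
  rw [hg j hj]
  congr 1
  refine sum_congr rfl fun i hi => hf i ?_
  simp only [mem_Ico] at *
  omega

theorem sum₂_neg_left (f g : ℕ → ZMod p) : sum₂ p (fun i => -f i) g = -sum₂ p f g := by
  simp [sum₂]

theorem sum₂_neg_right (f g : ℕ → ZMod p) : sum₂ p f (fun i => -g i) = -sum₂ p f g := by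
  simp [sum₂]

theorem sum_Ico_one_reflect {M : Type*} [AddCommMonoid M] (f : ℕ → M) (n : ℕ) :
    ∑ i ∈ Ico 1 n, f (n - i) = ∑ i ∈ Ico 1 n, f i := by
  refine sum_nbij' (fun i => n - i) (fun i => n - i) ?_ ?_ ?_ ?_ ?_ <;>
    (intro i hi; rw [mem_Ico] at *)
  · omega
  · omega
  · omega
  · omega

theorem sum₁_reflect (f : ℕ → ZMod p) : sum₁ p (fun i => f (p - i)) = sum₁ p f :=
  sum_Ico_one_reflect f p

theorem sum₂_reflect (f g : ℕ → ZMod p) :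
    sum₂ p f g = sum₂ p (fun i => g (p - i)) (fun i => f (p - i)) := by
  simp only [sum₂, sum_mul, sum_sigma']
  refine sum_nbij' (fun x => ⟨p - x.2, p - x.1⟩) (fun x => ⟨p - x.2, p - x.1⟩) ?_ ?_ ?_ ?_ ?_ <;>
    (rintro ⟨i, j⟩ h; simp only [mem_sigma, mem_Ico, Sigma.mk.injEq, heq_eq_eq] at *)
  · omega
  · omega
  · omega
  · omega
  · rw [show p - (p - i) = i by omega, show p - (p - j) = j by omega, mul_comm]

theorem sum_convolution (f g : ℕ → ZMod p) :
    ∑ n ∈ Ico 1 p, ∑ i ∈ Ico 1 n, f i * g (n - i) = sum₂ p f (fun k => g (p - k)) := by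
  simp only [sum₂, sum_mul, sum_sigma']
  refine sum_nbij' (fun x => ⟨p - (x.1 - x.2), x.2⟩) (fun x => ⟨p - (x.1 - x.2), x.2⟩)
    ?_ ?_ ?_ ?_ ?_ <;>
    (rintro ⟨n, i⟩ h; simp only [mem_sigma, mem_Ico, Sigma.mk.injEq, heq_eq_eq, and_true] at *)
  · omega
  · omega
  · omega
  · omega
  · rw [show p - (p - (n - i)) = n - i by omega]

variable [Fact p.Prime]

theorem sum₁_mul_sum₁ (f g : ℕ → ZMod p) :
    sum₁ p f * sum₁ p g = sum₂ p f g + sum₂ p g f + sum₁ p (fun i => f i * g i) := by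
  suffices h : ∀ n, (∑ j ∈ Ico 1 (n + 1), f j) * ∑ j ∈ Ico 1 (n + 1), g j =
      ∑ j ∈ Ico 1 (n + 1), (∑ i ∈ Ico 1 j, f i) * g j +
        ∑ j ∈ Ico 1 (n + 1), (∑ i ∈ Ico 1 j, g i) * f j +
        ∑ j ∈ Ico 1 (n + 1), f j * g j by
    have := h (p - 1)
    rwa [Nat.sub_add_cancel (Fact.out : p.Prime).one_le] at this
  intro n
  induction n with
  | zero => simp
  | succ n ih =>
    simp only [sum_Ico_succ_top (show 1 ≤ n + 1 by omega)]
    linear_combination ih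

theorem natCast_sub_self {i : ℕ} (hi : i ∈ Ico 1 p) : ((p - i : ℕ) : ZMod p) = -i := by
  rw [Nat.cast_sub (mem_Ico.1 hi).2.le]
  simp

theorem invPow_reflect (a : ℕ) {i : ℕ} (hi : i ∈ Ico 1 p) :
    invPow p a (p - i) = (-1) ^ a * invPow p a i := by
  rw [invPow, natCast_sub_self hi, inv_neg, neg_pow, invPow]

theorem altInvPow_reflect (hp : p ≠ 2) (a : ℕ) {i : ℕ} (hi : i ∈ Ico 1 p) :
    altInvPow p a (p - i) = -((-1) ^ a * altInvPow p a i) := by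
  have h : ((-1) ^ (p - i) : ZMod p) = -(-1) ^ i := by
    have h1 : ((-1) ^ (p - i) * (-1) ^ i : ZMod p) = -1 := by
      rw [← pow_add, Nat.sub_add_cancel (mem_Ico.1 hi).2.le]
      exact ((Fact.out : p.Prime).odd_of_ne_two hp).neg_one_pow
    have h2 : ((-1) ^ i * (-1) ^ i : ZMod p) = 1 := by rw [← mul_pow]; simp
    linear_combination (-1) ^ i * h1 - (-1) ^ (p - i) * h2
  rw [altInvPow, natCast_sub_self hi, inv_neg, neg_pow _ a, h, altInvPow]
  ring

theorem sum₁_invPow (m : ℕ) : sum₁ p (invPow p m) = if (p - 1) ∣ m then -1 else 0 := by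
  classical
  have hbij : sum₁ p (invPow p m) = ∑ u : (ZMod p)ˣ, ((u⁻¹ : (ZMod p)ˣ) : ZMod p) ^ m :=
    Finset.sum_bij'
      (fun v hv => Units.mk0 (v : ZMod p) (natCast_ne_zero_of_mem_Ico hv))
      (fun u _ => (u : ZMod p).val)
      (fun _ _ => Finset.mem_univ _)
      (fun u _ => by grind [u.ne_zero, ZMod.val_ne_zero, ZMod.val_lt])
      (fun v hv => by simp [ZMod.val_cast_of_lt (Finset.mem_Ico.mp hv).2])
      (fun u _ => Units.ext (ZMod.natCast_zmod_val _))
      (fun _ _ => by simp [invPow])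
  have hunits := FiniteField.sum_pow_units (ZMod p) m
  rw [ZMod.card] at hunits
  rw [hbij, ← hunits]
  exact Equiv.sum_comp (Equiv.inv (ZMod p)ˣ) (fun u => (u : ZMod p) ^ m)

theorem sum₁_invPow_eq_zero {m : ℕ} (h0 : 0 < m) (h : m < p - 1) : sum₁ p (invPow p m) = 0 := by
  rw [sum₁_invPow, if_neg (Nat.not_dvd_of_pos_of_lt h0 h)]

theorem two_ne_zero_of_ne_two (hp : p ≠ 2) : (2 : ZMod p) ≠ 0 := by
  have h2 := (Fact.out : p.Prime).two_le
  exact_mod_cast natCast_ne_zero_of_mem_Ico (p := p) (k := 2) (mem_Ico.2 ⟨by omega, by omega⟩)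

theorem sum₁_altInvPow_eq_zero_of_even (hp : p ≠ 2) {m : ℕ} (hm : Even m) :
    sum₁ p (altInvPow p m) = 0 := by
  have h := sum₁_reflect (altInvPow p m)
  rw [sum₁_congr fun i hi => altInvPow_reflect hp m hi, hm.neg_one_pow] at h
  simp only [one_mul, sum₁, sum_neg_distrib] at h
  have h2 := two_ne_zero_of_ne_two hp
  refine (mul_eq_zero.1 (?_ : (2 : ZMod p) * _ = 0)).resolve_left h2
  rw [sum₁]
  linear_combination -h

/-! ### Shuffle relations -/

theorem neg_one_pow_sub {i n : ℕ} (h : i ≤ n) :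
    ((-1) ^ (n - i) : ZMod p) = (-1) ^ n * (-1) ^ i := by
  obtain ⟨k, rfl⟩ := Nat.exists_eq_add_of_le h
  have h2 : ((-1) ^ i * (-1) ^ i : ZMod p) = 1 := by rw [← mul_pow]; simp
  rw [Nat.add_sub_cancel_left, pow_add]
  linear_combination -(-1) ^ k * h2

theorem inv_mul_inv_cube {F : Type*} [Field F] {a b : F} (ha : a ≠ 0) (hb : b ≠ 0)
    (hn : a + b ≠ 0) :
    a⁻¹ * b⁻¹ ^ 3 = (a⁻¹ + b⁻¹) * (a + b)⁻¹ ^ 3 + b⁻¹ ^ 2 * (a + b)⁻¹ ^ 2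
      + b⁻¹ ^ 3 * (a + b)⁻¹ := by
  field_simp
  ring

theorem inv_mul_inv_sq {F : Type*} [Field F] {a b : F} (ha : a ≠ 0) (hb : b ≠ 0)
    (hn : a + b ≠ 0) :
    a⁻¹ ^ 2 * b⁻¹ = (a⁻¹ + b⁻¹) * (a + b)⁻¹ ^ 2 + a⁻¹ ^ 2 * (a + b)⁻¹ := by
  field_simp
  ring

theorem convolution_ne_zero {i n : ℕ} (hn : n ∈ Ico 1 p) (hi : i ∈ Ico 1 n) :
    (i : ZMod p) ≠ 0 ∧ ((n - i : ℕ) : ZMod p) ≠ 0 ∧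
      (i : ZMod p) + ((n - i : ℕ) : ZMod p) = n ∧ (n : ZMod p) ≠ 0 := by
  rw [mem_Ico] at hn hi
  refine ⟨natCast_ne_zero_of_mem_Ico (mem_Ico.2 ⟨by omega, by omega⟩),
    natCast_ne_zero_of_mem_Ico (mem_Ico.2 ⟨by omega, by omega⟩), ?_,
    natCast_ne_zero_of_mem_Ico (mem_Ico.2 ⟨by omega, by omega⟩)⟩
  rw [← Nat.cast_add, Nat.add_sub_cancel' hi.2.le]

theorem shuffle_invPow_altInvPow (hp : p ≠ 2) :
    sum₂ p (invPow p 1) (altInvPow p 3) =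
      sum₂ p (altInvPow p 1) (altInvPow p 3) + sum₂ p (altInvPow p 1) (invPow p 3)
        + sum₂ p (altInvPow p 2) (invPow p 2) + sum₂ p (altInvPow p 3) (invPow p 1) := by
  have h := sum_convolution (invPow p 1) (altInvPow p 3)
  rw [sum₂_congr (fun _ _ => rfl) fun i hi => altInvPow_reflect hp 3 hi] at h
  have h0 : ((-1) ^ 3 : ZMod p) = -1 := by ring
  simp only [h0, neg_mul, one_mul, neg_neg] at h
  rw [← h]
  simp only [sum₂, ← sum_add_distrib]
  refine sum_congr rfl fun n hn => ?_
  have key : ∀ i ∈ Ico 1 n, invPow p 1 i * altInvPow p 3 (n - i) =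
      altInvPow p 1 i * altInvPow p 3 n + (altInvPow p 1 (n - i) * invPow p 3 n +
        altInvPow p 2 (n - i) * invPow p 2 n + altInvPow p 3 (n - i) * invPow p 1 n) := by
    intro i hi
    obtain ⟨h1, h2, h3, h4⟩ := convolution_ne_zero hn hi
    have e := inv_mul_inv_cube h1 h2 (h3 ▸ h4)
    rw [h3] at e
    have s := neg_one_pow_sub (p := p) (mem_Ico.1 hi).2.le
    simp only [invPow, altInvPow]
    rw [s]
    linear_combination (-1) ^ n * (-1) ^ i * e
  rw [sum_congr rfl key, sum_add_distrib,
    sum_Ico_one_reflect (fun i => altInvPow p 1 i * invPow p 3 n +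
        altInvPow p 2 i * invPow p 2 n + altInvPow p 3 i * invPow p 1 n) n]
  simp only [sum_add_distrib, sum_mul]
  ring

theorem shuffle_altInvPow_invPow :
    -sum₂ p (altInvPow p 1) (invPow p 3) =
      sum₂ p (altInvPow p 1) (invPow p 3) + sum₂ p (altInvPow p 1) (altInvPow p 3)
        + sum₂ p (altInvPow p 2) (altInvPow p 2) + sum₂ p (altInvPow p 3) (altInvPow p 1) := by
  have h := sum_convolution (altInvPow p 1) (invPow p 3)
  rw [sum₂_congr (fun _ _ => rfl) fun i hi => invPow_reflect 3 hi] at h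
  have h0 : ((-1) ^ 3 : ZMod p) = -1 := by ring
  simp only [h0, neg_mul, one_mul, sum₂_neg_right] at h
  rw [← h]
  simp only [sum₂, ← sum_add_distrib]
  refine sum_congr rfl fun n hn => ?_
  have key : ∀ i ∈ Ico 1 n, altInvPow p 1 i * invPow p 3 (n - i) =
      altInvPow p 1 i * invPow p 3 n + (altInvPow p 1 (n - i) * altInvPow p 3 n +
        altInvPow p 2 (n - i) * altInvPow p 2 n + altInvPow p 3 (n - i) * altInvPow p 1 n) := by
    intro i hi
    obtain ⟨h1, h2, h3, h4⟩ := convolution_ne_zero hn hi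
    have e := inv_mul_inv_cube h1 h2 (h3 ▸ h4)
    rw [h3] at e
    have s := neg_one_pow_sub (p := p) (mem_Ico.1 hi).2.le
    have s2 : ((-1) ^ n * (-1) ^ n : ZMod p) = 1 := by rw [← mul_pow]; simp
    simp only [invPow, altInvPow]
    rw [s]
    set x : ZMod p := (i : ZMod p)⁻¹
    set y : ZMod p := ((n - i : ℕ) : ZMod p)⁻¹
    set z : ZMod p := (n : ZMod p)⁻¹
    linear_combination (-1) ^ i * e - (-1) ^ i * (y * z ^ 3 + y ^ 2 * z ^ 2 + y ^ 3 * z) * s2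
  rw [sum_congr rfl key, sum_add_distrib,
    sum_Ico_one_reflect (fun i => altInvPow p 1 i * altInvPow p 3 n +
        altInvPow p 2 i * altInvPow p 2 n + altInvPow p 3 i * altInvPow p 1 n) n]
  simp only [sum_add_distrib, sum_mul]
  ring

theorem sum₂_altInvPow_one_invPow_three (hp : p ≠ 2) (h4 : 4 < p - 1) :
    2 * sum₂ p (altInvPow p 1) (invPow p 3) = -(sum₁ p (altInvPow p 1) * sum₁ p (altInvPow p 3)) ∧
      sum₂ p (altInvPow p 1) (invPow p 3) = -sum₂ p (altInvPow p 1) (altInvPow p 3) := by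
  have hs : ∀ i : ℕ, ((-1) ^ i * (-1) ^ i : ZMod p) = 1 := fun i => by rw [← mul_pow]; simp
  have hM : ∀ a b : ℕ, a + b = 4 → sum₁ p (fun i => altInvPow p a i * altInvPow p b i) = 0 := by
    intro a b hab
    rw [← sum₁_invPow_eq_zero (p := p) (m := 4) (by omega) h4]
    refine sum₁_congr fun i _ => ?_
    rw [altInvPow, altInvPow, invPow, ← hab, pow_add]
    linear_combination (i : ZMod p)⁻¹ ^ a * (i : ZMod p)⁻¹ ^ b * hs i
  have h22 := sum₁_mul_sum₁ (altInvPow p 2) (altInvPow p 2)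
  rw [sum₁_altInvPow_eq_zero_of_even hp even_two, hM 2 2 rfl] at h22
  have h13 := sum₁_mul_sum₁ (altInvPow p 1) (altInvPow p 3)
  rw [hM 1 3 rfl] at h13
  have hr := sum₂_reflect (altInvPow p 1) (altInvPow p 3)
  rw [sum₂_congr (fun i hi => altInvPow_reflect hp 3 hi) (fun i hi => altInvPow_reflect hp 1 hi)]
    at hr
  have h0 : ((-1) ^ 3 : ZMod p) = -1 := by ring
  simp only [h0, pow_one, neg_mul, one_mul, neg_neg] at hr
  have h := shuffle_altInvPow_invPow (p := p)
  change _ = sum₂ p (altInvPow p 3) (altInvPow p 1) at hr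
  have h2 := two_ne_zero_of_ne_two hp
  have h22' : sum₂ p (altInvPow p 2) (altInvPow p 2) = 0 :=
    (mul_eq_zero.1 (by linear_combination -h22)).resolve_left h2
  refine ⟨mul_left_cancel₀ h2 ?_, mul_left_cancel₀ h2 ?_⟩
  · linear_combination (-2) * h + 2 * h13 - 2 * h22'
  · linear_combination -h + hr - h22'

theorem sum₂_altInvPow_two_invPow_two (hp : p ≠ 2) (h4 : 4 < p - 1) :
    sum₂ p (altInvPow p 2) (invPow p 2) = 2 * sum₂ p (invPow p 1) (altInvPow p 3) := by
  have h := shuffle_invPow_altInvPow hp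
  have hD := (sum₂_altInvPow_one_invPow_three hp h4).2
  have hr := sum₂_reflect (invPow p 1) (altInvPow p 3)
  rw [sum₂_congr (fun i hi => altInvPow_reflect hp 3 hi) (fun i hi => invPow_reflect 1 hi)]
    at hr
  have h0 : ((-1) ^ 3 : ZMod p) = -1 := by ring
  simp only [h0, pow_one, neg_mul, one_mul, neg_neg, sum₂_neg_right] at hr
  change _ = -sum₂ p (altInvPow p 3) (invPow p 1) at hr
  linear_combination -h - hD - hr

/-! ### Vanishing of the convolution of Bernoulli numbers -/

theorem sum₂_invPow_one_three (hp : p ≠ 2) (h4 : 4 < p - 1) :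
    sum₂ p (invPow p 1) (invPow p 3) = 0 := by
  have h := sum₁_mul_sum₁ (invPow p 1) (invPow p 3)
  have hM : sum₁ p (fun i => invPow p 1 i * invPow p 3 i) = 0 := by
    rw [← sum₁_invPow_eq_zero (p := p) (m := 4) (by omega) h4]
    exact sum₁_congr fun i _ => by simp only [invPow]; ring
  rw [hM, sum₁_invPow_eq_zero (m := 1) (by omega) (by omega)] at h
  have hr := sum₂_reflect (invPow p 1) (invPow p 3)
  rw [sum₂_congr (fun i hi => invPow_reflect 3 hi) (fun i hi => invPow_reflect 1 hi)] at hr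
  have h0 : ((-1) ^ 3 : ZMod p) = -1 := by ring
  simp only [h0, pow_one, neg_mul, one_mul, sum₂_neg_left, sum₂_neg_right, neg_neg] at hr
  refine (mul_eq_zero.1 (?_ : (2 : ZMod p) * _ = 0)).resolve_left (two_ne_zero_of_ne_two hp)
  linear_combination hr - h

/-- The harmonic number `∑_{1 ≤ i < n} 1 / i` modulo `p`. -/
def harm (p n : ℕ) : ZMod p := ∑ i ∈ Ico 1 n, invPow p 1 i

theorem harm_sq (n : ℕ) :
    harm p n ^ 2 = 2 * (∑ i ∈ Ico 1 n, harm p i * invPow p 1 i) + ∑ i ∈ Ico 1 n, invPow p 2 i := by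
  induction n with
  | zero => simp [harm]
  | succ n ih =>
    rcases Nat.eq_zero_or_pos n with rfl | hn
    · simp [harm]
    · have hs : harm p (n + 1) = harm p n + invPow p 1 n := sum_Ico_succ_top hn _
      rw [hs, sum_Ico_succ_top hn, sum_Ico_succ_top hn]
      have h2 : invPow p 2 n = invPow p 1 n ^ 2 := by simp only [invPow]; ring
      rw [h2]
      linear_combination ih

theorem sum_harm_mul_invPow_sub {n : ℕ} (hn : n ≤ p) :
    ∑ i ∈ Ico 1 n, harm p i * invPow p 1 (n - i) = 2 * ∑ i ∈ Ico 1 n, harm p i * invPow p 1 i := by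
  induction n with
  | zero => simp
  | succ n ih =>
    rcases Nat.eq_zero_or_pos n with rfl | hn0
    · simp
    have hnp : n ∈ Ico 1 p := mem_Ico.2 ⟨hn0, by omega⟩
    have hstep : ∀ i ∈ Ico 1 n, harm p (i + 1) * invPow p 1 (n - i) =
        harm p i * invPow p 1 (n - i) + (invPow p 1 i + invPow p 1 (n - i)) * invPow p 1 n := by
      intro i hi
      obtain ⟨h1, h2, h3, h4⟩ := convolution_ne_zero hnp hi
      have hs : harm p (i + 1) = harm p i + invPow p 1 i := sum_Ico_succ_top (mem_Ico.1 hi).1 _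
      rw [hs, add_mul, add_right_inj]
      simp only [invPow, pow_one]
      rw [← h3] at h4 ⊢
      field_simp
      ring
    rw [sum_eq_sum_Ico_succ_bot (by omega : 1 < n + 1), sum_Ico_succ_top hn0,
      ← sum_Ico_add' (fun i => harm p i * invPow p 1 (n + 1 - i)) 1 n 1]
    simp only [Nat.add_sub_add_right]
    rw [sum_congr rfl hstep, sum_add_distrib, ih (by omega), ← sum_mul, sum_add_distrib,
      sum_Ico_one_reflect (invPow p 1) n]
    simp only [harm, Ico_self, sum_empty]
    ring

theorem sum₁_harm_sq (hp : p ≠ 2) (h4 : 4 < p - 1) :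
    sum₁ p (fun j => harm p j ^ 2 * invPow p 2 j) = 0 := by
  set Q := sum₁ p (fun j => harm p j ^ 2 * invPow p 2 j) with hQ
  have h2 := two_ne_zero_of_ne_two hp
  have h22 : sum₂ p (invPow p 2) (invPow p 2) = 0 := by
    have h := sum₁_mul_sum₁ (invPow p 2) (invPow p 2)
    have hM : sum₁ p (fun i => invPow p 2 i * invPow p 2 i) = 0 := by
      rw [← sum₁_invPow_eq_zero (p := p) (m := 4) (by omega) h4]
      exact sum₁_congr fun i _ => by simp only [invPow]; ring
    rw [hM, sum₁_invPow_eq_zero (m := 2) (by omega) (by omega)] at h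
    refine (mul_eq_zero.1 (?_ : (2 : ZMod p) * _ = 0)).resolve_left h2
    linear_combination -h
  have hP : Q = 2 * sum₂ p (fun i => harm p i * invPow p 1 i) (invPow p 2) := by
    rw [← add_zero (2 * _), ← h22, hQ]
    simp only [sum₁, sum₂]
    rw [mul_sum, ← sum_add_distrib]
    refine sum_congr rfl fun j _ => ?_
    rw [harm_sq]
    ring
  have hR : sum₂ p (fun i => harm p i * invPow p 2 i) (invPow p 1) = -Q := by
    have h := sum₁_mul_sum₁ (invPow p 1) (fun i => harm p i * invPow p 2 i)
    have h13 := sum₂_invPow_one_three hp h4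
    have e1 : sum₁ p (fun i => invPow p 1 i * (harm p i * invPow p 2 i)) = 0 := by
      rw [← h13]
      refine sum_congr rfl fun i _ => ?_
      simp only [harm, invPow]
      ring
    have e2 : sum₂ p (invPow p 1) (fun i => harm p i * invPow p 2 i) = Q := by
      refine sum_congr rfl fun i _ => ?_
      simp only [harm]
      ring
    rw [e1, e2, sum₁_invPow_eq_zero (m := 1) (by omega) (by omega)] at h
    linear_combination -h
  have hconv := sum_convolution (fun i => harm p i * invPow p 2 i) (invPow p 1)
  rw [sum₂_congr (fun _ _ => rfl) fun i hi => invPow_reflect 1 hi] at hconv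
  simp only [pow_one, neg_mul, one_mul, sum₂_neg_right, hR, neg_neg] at hconv
  have hexp : ∑ n ∈ Ico 1 p, ∑ i ∈ Ico 1 n, harm p i * invPow p 2 i * invPow p 1 (n - i) =
      3 * sum₂ p (fun i => harm p i * invPow p 1 i) (invPow p 2)
        + sum₂ p (fun i => harm p i * invPow p 2 i) (invPow p 1) := by
    simp only [sum₂, mul_sum, ← sum_add_distrib]
    refine sum_congr rfl fun n hn => ?_
    have key : ∀ i ∈ Ico 1 n, harm p i * invPow p 2 i * invPow p 1 (n - i) =
        harm p i * invPow p 1 (n - i) * invPow p 2 n + harm p i * invPow p 1 i * invPow p 2 n +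
          harm p i * invPow p 2 i * invPow p 1 n := by
      intro i hi
      obtain ⟨h1, h2, h3, h4⟩ := convolution_ne_zero hn hi
      have e := inv_mul_inv_sq h1 h2 (h3 ▸ h4)
      rw [h3] at e
      simp only [invPow, pow_one]
      linear_combination harm p i * e
    rw [sum_congr rfl key]
    simp only [sum_add_distrib, ← sum_mul]
    rw [sum_harm_mul_invPow_sub (mem_Ico.1 hn).2.le]
    ring
  rw [hexp, hR] at hconv
  linear_combination (-2) * hconv - 3 * hP

theorem choose_pred_prime {r : ℕ} (hr : r < p) : ((p - 1).choose r : ZMod p) = (-1) ^ r := by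
  induction r with
  | zero => simp
  | succ r ih =>
    have h := Nat.choose_succ_succ (p - 1) r
    rw [Nat.succ_eq_add_one, Nat.sub_add_cancel (Fact.out : p.Prime).one_le] at h
    have h0 : (p.choose (r + 1) : ZMod p) = 0 :=
      (ZMod.natCast_eq_zero_iff _ _).2 ((Fact.out : p.Prime).dvd_choose_self (by omega) hr)
    rw [h] at h0
    push_cast at h0
    rw [ih (by omega)] at h0
    rw [pow_succ]
    linear_combination h0

theorem choose_pred_pred_prime {r : ℕ} (hr : r < p) :
    ((p - 2).choose r : ZMod p) = (-1) ^ r * (r + 1) := by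
  induction r with
  | zero => simp
  | succ r ih =>
    have h := Nat.choose_succ_succ (p - 2) r
    have h2 := (Fact.out : p.Prime).two_le
    rw [Nat.succ_eq_add_one, show p - 2 + 1 = p - 1 by omega] at h
    have h0 := choose_pred_prime hr
    rw [h] at h0
    push_cast at h0 ⊢
    rw [ih (by omega)] at h0
    rw [pow_succ] at *
    linear_combination h0

theorem pow_sub_eq_invPow {j r : ℕ} (hj : j ∈ Ico 1 p) (hr : r ≤ p - 1) :
    (j : ZMod p) ^ (p - 1 - r) = invPow p r j := by
  have h0 := natCast_ne_zero_of_mem_Ico hj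
  have h1 := ZMod.pow_card_sub_one_eq_one h0
  rw [invPow, inv_pow, ← mul_eq_one_iff_eq_inv₀ (pow_ne_zero _ h0), ← pow_add,
    Nat.sub_add_cancel hr, h1]

theorem sum_invPow_eq_bern {a j : ℕ} (ha : 0 < a) (hap : a < p - 1) (hj : j ∈ Ico 1 p) :
    -a * ∑ i ∈ Ico 1 j, invPow p a i =
      ∑ r ∈ range (p - a), bern p r * ((p - a).choose r) * invPow p (r + a - 1) j := by
  have hj' := mem_Ico.1 hj
  have h := sum_range_pow_eq_bern (p := p) (m := p - 1 - a) (by omega) j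
  have hne := natCast_ne_zero_of_mem_Ico (p := p) (k := p - 1 - a + 1)
    (mem_Ico.2 ⟨by omega, by omega⟩)
  have hcast : ((p - 1 - a + 1 : ℕ) : ZMod p) = -a := by
    rw [show p - 1 - a + 1 = p - a by omega]
    exact natCast_sub_self (mem_Ico.2 ⟨ha, by omega⟩)
  rw [range_eq_Ico, sum_eq_sum_Ico_succ_bot (by omega), Nat.cast_zero, zero_pow (by omega),
    zero_add, ← sum_div, eq_div_iff hne, hcast, show p - 1 - a + 1 = p - a by omega] at h
  rw [mul_comm]
  have e : ∑ i ∈ Ico 1 j, invPow p a i = ∑ i ∈ Ico (0 + 1) j, (i : ZMod p) ^ (p - 1 - a) := by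
    refine sum_congr rfl fun i hi => ?_
    simp only [mem_Ico] at hi
    exact (pow_sub_eq_invPow (mem_Ico.2 ⟨by omega, by omega⟩) (by omega)).symm
  rw [e, h]
  refine sum_congr rfl fun r hr => ?_
  have hr := mem_range.1 hr
  rw [← pow_sub_eq_invPow hj (by omega), show p - 1 - (r + a - 1) = p - a - r by omega]

theorem bern_pred_pred (hp : 3 < p) : bern p (p - 2) = 0 :=
  bern_eq_zero_of_odd (Nat.Odd.sub_even (by omega)
    ((Fact.out : p.Prime).odd_of_ne_two (by omega)) even_two) (by omega)

theorem harm_eq_bern (hp : 3 < p) {j : ℕ} (hj : j ∈ Ico 1 p) :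
    harm p j = -∑ r ∈ range (p - 2), (-1) ^ r * bern p r * invPow p r j := by
  have h := sum_invPow_eq_bern (a := 1) one_pos (by omega) hj
  rw [show p - 1 = p - 2 + 1 by omega, sum_range_succ, bern_pred_pred hp] at h
  rw [harm, neg_eq_iff_eq_neg.symm, ← neg_one_mul]
  rw [Nat.cast_one] at h
  rw [h, zero_mul, zero_mul, add_zero]
  refine sum_congr rfl fun r hr => ?_
  have hr := mem_range.1 hr
  rw [show p - 2 + 1 = p - 1 by omega, choose_pred_prime (by omega), Nat.add_sub_cancel]
  ring

theorem sum_invPow_two_eq_bern (hp : 3 < p) {j : ℕ} (hj : j ∈ Ico 1 p) :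
    2 * ∑ i ∈ Ico 1 j, invPow p 2 i =
      -∑ r ∈ range (p - 2), (-1) ^ r * (r + 1) * bern p r * invPow p (r + 1) j := by
  have h := sum_invPow_eq_bern (a := 2) two_pos (by omega) hj
  rw [neg_eq_iff_eq_neg.symm, ← neg_mul]
  rw [Nat.cast_two] at h
  rw [h]
  refine sum_congr rfl fun r hr => ?_
  have hr := mem_range.1 hr
  rw [choose_pred_pred_prime (by omega), show r + 2 - 1 = r + 1 by omega]
  ring

theorem sum_bern_mul_bern (hp : 7 ≤ p) :
    ∑ r ∈ range (p - 2), bern p r * bern p (p - 3 - r) = 0 := by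
  rw [← neg_eq_zero, ← sum₁_harm_sq (p := p) (by omega) (by omega)]
  have h1 : sum₁ p (fun j => harm p j ^ 2 * invPow p 2 j) =
      sum₁ p (fun j => ∑ r ∈ range (p - 2), ∑ s ∈ range (p - 2),
        (-1) ^ (r + s) * bern p r * bern p s * invPow p (r + s + 2) j) := by
    refine sum₁_congr fun j hj => ?_
    rw [harm_eq_bern (by omega) hj, neg_sq, sq, sum_mul_sum, sum_mul]
    refine sum_congr rfl fun r _ => ?_
    rw [sum_mul]
    refine sum_congr rfl fun s _ => ?_
    simp only [invPow]
    ring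
  rw [h1, sum₁, sum_comm, ← sum_neg_distrib]
  refine sum_congr rfl fun r hr => ?_
  have hr := mem_range.1 hr
  rw [sum_comm, sum_eq_single (p - 3 - r)]
  · rw [← mul_sum, ← sum₁, sum₁_invPow, if_pos (by rw [show r + (p - 3 - r) + 2 = p - 1 by omega]),
      show r + (p - 3 - r) = p - 3 by omega, Even.neg_one_pow]
    · ring
    · exact Nat.Odd.sub_odd ((Fact.out : p.Prime).odd_of_ne_two (by omega)) (by decide)
  · intro s hs hne
    have hs := mem_range.1 hs
    rw [← mul_sum, ← sum₁, sum₁_invPow, if_neg, mul_zero]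
    rintro ⟨c, hc⟩
    have : c < 2 := by
      by_contra hcon
      have : (p - 1) * 2 ≤ (p - 1) * c := Nat.mul_le_mul_left _ (by omega)
      omega
    interval_cases c <;> omega
  · intro hn
    exact absurd (mem_range.2 (by omega)) hn

/-! ### Alternating power sums -/

theorem sum_neg_one_pow_mul {R : Type*} [CommRing R] (g : ℕ → R) (h : ℕ) :
    ∑ j ∈ range (2 * h + 1), (-1) ^ j * g j =
      2 * ∑ i ∈ range (h + 1), g (2 * i) - ∑ j ∈ range (2 * h + 1), g j := by
  induction h with
  | zero => simp; ring
  | succ h ih =>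
    rw [show 2 * (h + 1) + 1 = 2 * h + 1 + 1 + 1 by ring, sum_range_succ, sum_range_succ, ih,
      sum_range_succ _ (h + 1), sum_range_succ _ (2 * h + 1 + 1), sum_range_succ _ (2 * h + 1),
      show 2 * (h + 1) = 2 * h + 1 + 1 by ring]
    have hev : ((-1) ^ (2 * h) : R) = 1 := (even_two_mul h).neg_one_pow
    linear_combination (g (2 * h + 2) - g (2 * h + 1)) * hev

theorem sum_bern_mul_two_pow {n : ℕ} (hn : n + 1 < p) :
    ∑ i ∈ range (n + 1), bern p i * n.choose i * 2 ^ i = (2 - 2 ^ n) * bern p n := by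
  have h1 : ReducesTo p (∑ i ∈ range (n + 1), bernoulli i * n.choose i * 2 ^ i)
      (∑ i ∈ range (n + 1), bern p i * n.choose i * 2 ^ i) :=
    ReducesTo.sum fun i hi => ((reducesTo_bernoulli (by have := mem_range.1 hi; omega)).mul
      (ReducesTo.natCast _)).mul ((ReducesTo.ofNat 2).pow i)
  rw [sum_bernoulli_mul_two_pow] at h1
  exact h1.unique (((ReducesTo.ofNat 2).sub ((ReducesTo.ofNat 2).pow n)).mul
    (reducesTo_bernoulli hn))

theorem mul_sum₁_altInvPow (hp : p ≠ 2) {m : ℕ} (hm : 1 < m) (hmp : m + 1 < p) :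
    (m : ZMod p) * sum₁ p (altInvPow p m) = (2 ^ (p - m + 1) - 2) * bern p (p - m) := by
  obtain ⟨h, hh⟩ := (Fact.out : p.Prime).odd_of_ne_two hp
  obtain ⟨e, rfl⟩ : ∃ e, m = p - 1 - e := ⟨p - 1 - m, by omega⟩
  have he : 0 < e := by omega
  have hee : e + 2 < p := by omega
  have hn : p - (p - 1 - e) = e + 1 := by omega
  have hcast : ((p - 1 - e : ℕ) : ZMod p) = -((e + 1 : ℕ) : ZMod p) := by
    rw [show p - 1 - e = p - (e + 1) by omega]
    exact natCast_sub_self (mem_Ico.2 ⟨by omega, by omega⟩)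
  have hne := natCast_ne_zero_of_mem_Ico (p := p) (k := e + 1) (mem_Ico.2 ⟨by omega, by omega⟩)
  have hall : ∑ j ∈ range p, (j : ZMod p) ^ e = 0 := by
    rw [sum_range_pow_eq_bern (by omega)]
    refine sum_eq_zero fun i hi => ?_
    have hi := mem_range.1 hi
    rw [ZMod.natCast_self, zero_pow (by omega)]
    simp
  have halt : sum₁ p (altInvPow p (p - 1 - e)) = ∑ j ∈ range p, (-1) ^ j * (j : ZMod p) ^ e := by
    rw [range_eq_Ico, sum_eq_sum_Ico_succ_bot (by omega), Nat.cast_zero, zero_pow he.ne', mul_zero,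
      zero_add]
    refine sum_congr rfl fun j hj => ?_
    have := pow_sub_eq_invPow (r := p - 1 - e) hj (by omega)
    rw [show p - 1 - (p - 1 - e) = e by omega] at this
    rw [this, altInvPow, invPow]
  have hx : (2 : ZMod p) * ((h + 1 : ℕ) : ZMod p) = 1 := by
    have : ((2 * h + 1 : ℕ) : ZMod p) = 0 := by rw [← hh]; simp
    push_cast at this ⊢
    linear_combination this
  have hhalf : 2 ^ (e + 1) * (((e + 1 : ℕ) : ZMod p) * ∑ i ∈ range (h + 1), (i : ZMod p) ^ e) =
      (2 - 2 ^ (e + 1)) * bern p (e + 1) - 2 ^ (e + 1) * bern p (e + 1) := by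
    rw [← sum_bern_mul_two_pow (by omega), sum_range_succ _ (e + 1),
      sum_range_pow_eq_bern (by omega), ← sum_div, mul_div_cancel₀ _ hne, mul_sum]
    rw [Nat.choose_self, Nat.cast_one, mul_one, mul_comm (bern p (e + 1)), add_sub_cancel_right]
    refine sum_congr rfl fun r hr => ?_
    have hr := mem_range.1 hr
    obtain ⟨k, hk⟩ := Nat.exists_eq_add_of_le hr.le
    have hk1 : e + 1 - r = k := by omega
    rw [hk1]
    have h2 : (2 : ZMod p) ^ (e + 1) * ((h + 1 : ℕ) : ZMod p) ^ k = 2 ^ r := by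
      rw [hk, pow_add, mul_assoc, ← mul_pow, hx, one_pow, mul_one]
    linear_combination bern p r * ((e + 1).choose r : ZMod p) * h2
  have hsplit := sum_neg_one_pow_mul (fun j => (j : ZMod p) ^ e) h
  rw [← hh, hall] at hsplit
  simp only [Nat.cast_mul, Nat.cast_ofNat, mul_pow, ← mul_sum] at hsplit
  rw [halt, hsplit, hn, hcast]
  linear_combination -hhalf

theorem weight_mul_sum₁_altInvPow (hp : 7 ≤ p) {r : ℕ} (hr : r ∈ range (p - 2)) :
    (-1) ^ r * (r + 3) * bern p r * sum₁ p (altInvPow p (r + 3)) =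
      2 * (2 ^ (p - 3 - r) - 1) * (bern p r * bern p (p - 3 - r)) := by
  have hr := mem_range.1 hr
  have hodd := (Fact.out : p.Prime).odd_of_ne_two (by omega)
  rcases Nat.lt_or_ge r (p - 4) with h | h
  · have hT := mul_sum₁_altInvPow (p := p) (m := r + 3) (by omega) (by omega) (by omega)
    rw [show p - (r + 3) = p - 3 - r by omega] at hT
    push_cast at hT
    rcases Nat.even_or_odd r with he | ho
    · rw [he.neg_one_pow]
      rw [pow_succ] at hT
      linear_combination bern p r * hT
    · rcases Nat.lt_or_ge 1 r with h1 | h1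
      · rw [bern_eq_zero_of_odd ho h1]
        ring
      · have hr1 : r = 1 := by have := ho.pos; omega
        subst hr1
        rw [show p - 3 - 1 = p - 4 by omega,
          bern_eq_zero_of_odd (Nat.Odd.sub_even (by omega) hodd (by decide)) (by omega),
          sum₁_altInvPow_eq_zero_of_even (by omega) (by decide)]
        ring
  · rcases Nat.lt_or_ge r (p - 3) with h3 | h3
    · rw [show r = p - 4 by omega,
        bern_eq_zero_of_odd (Nat.Odd.sub_even (by omega) hodd (by decide)) (by omega)]
      ring
    · have hr3 : r = p - 3 := by omega
      have h0 : ((r : ZMod p) + 3) = 0 := by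
        have : ((r + 3 : ℕ) : ZMod p) = 0 := by rw [show r + 3 = p by omega]; simp
        exact_mod_cast this
      rw [h0, hr3]
      simp

theorem sum₂_invPow_one_altInvPow_three (hp : 7 ≤ p) :
    sum₂ p (invPow p 1) (altInvPow p 3) =
      ∑ k ∈ range (p - 2), 2 ^ k * bern p k * bern p (p - 3 - k) := by
  have h2 := two_ne_zero_of_ne_two (p := p) (by omega)
  have hA : sum₂ p (invPow p 1) (altInvPow p 3) =
      -∑ r ∈ range (p - 2), (-1) ^ r * bern p r * sum₁ p (altInvPow p (r + 3)) := by
    simp only [sum₁, mul_sum]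
    rw [sum_comm, ← sum_neg_distrib]
    refine sum_congr rfl fun j hj => ?_
    change harm p j * _ = _
    rw [harm_eq_bern (by omega) hj, neg_mul, sum_mul]
    congr 1
    refine sum_congr rfl fun r _ => ?_
    simp only [invPow, altInvPow]
    ring
  have hB : 2 * sum₂ p (invPow p 2) (altInvPow p 2) =
      -∑ r ∈ range (p - 2), (-1) ^ r * (r + 1) * bern p r * sum₁ p (altInvPow p (r + 3)) := by
    simp only [sum₁, sum₂, mul_sum]
    rw [sum_comm, ← sum_neg_distrib]
    refine sum_congr rfl fun j hj => ?_
    rw [← mul_assoc, sum_invPow_two_eq_bern (by omega) hj, neg_mul, sum_mul]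
    congr 1
    refine sum_congr rfl fun r _ => ?_
    simp only [invPow, altInvPow]
    ring
  have hr := sum₂_reflect (invPow p 2) (altInvPow p 2)
  rw [sum₂_congr (fun i hi => altInvPow_reflect (by omega) 2 hi) (fun i hi => invPow_reflect 2 hi)]
    at hr
  simp only [even_two.neg_one_pow, one_mul, sum₂_neg_left] at hr
  change _ = -sum₂ p (altInvPow p 2) (invPow p 2) at hr
  rw [sum₂_altInvPow_two_invPow_two (by omega) (by omega)] at hr
  have hsum : 2 * sum₂ p (invPow p 1) (altInvPow p 3) =
      ∑ r ∈ range (p - 2), (-1) ^ r * (r + 3) * bern p r * sum₁ p (altInvPow p (r + 3)) := by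
    have hsplit : ∑ r ∈ range (p - 2),
        (-1) ^ r * (r + 3) * bern p r * sum₁ p (altInvPow p (r + 3)) =
        (∑ r ∈ range (p - 2), (-1) ^ r * (r + 1) * bern p r * sum₁ p (altInvPow p (r + 3))) +
        2 * ∑ r ∈ range (p - 2), (-1) ^ r * bern p r * sum₁ p (altInvPow p (r + 3)) := by
      rw [mul_sum, ← sum_add_distrib]
      exact sum_congr rfl fun r _ => by ring
    rw [hsplit]
    linear_combination -hB + 2 * hr - 2 * hA
  rw [sum_congr rfl fun r hr => weight_mul_sum₁_altInvPow hp hr] at hsum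
  simp only [mul_assoc, ← mul_sum] at hsum
  rw [mul_left_cancel₀ h2 hsum]
  simp only [sub_mul, one_mul, sum_sub_distrib, sum_bern_mul_bern hp, sub_zero]
  rw [← sum_range_reflect]
  refine sum_congr rfl fun k hk => ?_
  have hk := mem_range.1 hk
  rw [show p - 2 - 1 - k = p - 3 - k by omega, show p - 3 - (p - 3 - k) = k by omega]
  ring

theorem two_mul_sum₁_altInvPow_three (hp : 7 ≤ p) :
    2 * sum₁ p (altInvPow p 3) = -bern p (p - 3) := by
  have h := mul_sum₁_altInvPow (p := p) (m := 3) (by omega) (by omega) (by omega)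
  have h2 := two_ne_zero_of_ne_two (p := p) (by omega)
  have h1 := ZMod.pow_card_sub_one_eq_one h2
  rw [show p - 1 = p - 3 + 1 + 1 by omega, pow_succ] at h1
  have h3 : ((3 : ℕ) : ZMod p) ≠ 0 := natCast_ne_zero_of_mem_Ico (mem_Ico.2 ⟨by omega, by omega⟩)
  refine mul_left_cancel₀ h3 ?_
  push_cast at h ⊢
  linear_combination 2 * h + bern p (p - 3) * h1

/-! ### Transfer from the rational numbers -/

theorem reducesTo_sgn (s : ℤ) : ReducesTo p (sgn s) (if s < 0 then -1 else 1) := by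
  unfold sgn
  split_ifs
  · exact ReducesTo.one.neg
  · exact ReducesTo.one

theorem reducesTo_H (s t : ℤ) :
    ReducesTo p (H [s, t] (p - 1))
      (sum₂ p (fun i => (if s < 0 then -1 else 1) ^ i * (i : ZMod p)⁻¹ ^ s.natAbs)
        (fun i => (if t < 0 then -1 else 1) ^ i * (i : ZMod p)⁻¹ ^ t.natAbs)) := by
  have hterm : ∀ (u : ℤ) {k : ℕ}, k ∈ Ico 1 p → ReducesTo p (sgn u ^ k / (k : ℚ) ^ u.natAbs)
      ((if u < 0 then -1 else 1) ^ k * (k : ZMod p)⁻¹ ^ u.natAbs) := by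
    intro u k hk
    rw [inv_pow, ← div_eq_mul_inv]
    exact ((reducesTo_sgn u).pow k).div ((ReducesTo.natCast k).pow _)
      (pow_ne_zero _ (natCast_ne_zero_of_mem_Ico hk))
  have hp := (Fact.out : p.Prime).one_le
  have hIcc : ∀ k, 1 ≤ k → Icc 1 (k - 1) = Ico 1 k := by
    intro k hk
    ext i
    simp only [mem_Icc, mem_Ico]
    omega
  simp only [H, List.reverse_cons, List.reverse_nil, List.nil_append, List.cons_append, Hrev,
    mul_one, hIcc p hp]
  refine ReducesTo.sum fun j hj => ?_
  have hj' := mem_Ico.1 hj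
  rw [hIcc j hj'.1, mul_comm]
  refine (ReducesTo.sum fun i hi => hterm s ?_).mul (hterm t hj)
  rw [mem_Ico] at hi ⊢
  omega

theorem two_mul_qp : 2 * qp p = ∑ k ∈ Ico 1 p, ((p - 1).choose (k - 1) : ℚ) / k := by
  have hp := (Fact.out : p.Prime).two_le
  have hp0 : (p : ℚ) ≠ 0 := by exact_mod_cast (Fact.out : p.Prime).ne_zero
  have h := Nat.sum_range_choose p
  rw [sum_range_succ, range_eq_Ico, sum_eq_sum_Ico_succ_bot (by omega)] at h
  have hterm : ∀ k ∈ Ico (0 + 1) p, (p.choose k : ℚ) = p * (((p - 1).choose (k - 1) : ℚ) / k) := by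
    intro k hk
    rw [mem_Ico] at hk
    have hk0 : (k : ℚ) ≠ 0 := by
      have : k ≠ 0 := by omega
      exact_mod_cast this
    have := Nat.add_one_mul_choose_eq (p - 1) (k - 1)
    rw [show p - 1 + 1 = p by omega, show k - 1 + 1 = k by omega] at this
    field_simp
    exact_mod_cast this.symm
  have hq : (2 : ℚ) ^ p = 2 + ∑ k ∈ Ico (0 + 1) p, (p.choose k : ℚ) := by
    have : (2 ^ p : ℕ) = 2 + ∑ k ∈ Ico (0 + 1) p, p.choose k := by
      rw [← h, Nat.choose_zero_right, Nat.choose_self]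
      ring
    exact_mod_cast this
  rw [sum_congr rfl hterm, ← mul_sum, show p = p - 1 + 1 by omega, pow_succ,
    show p - 1 + 1 = p by omega] at hq
  rw [qp]
  field_simp
  linear_combination hq

theorem reducesTo_qp (hp : p ≠ 2) : ReducesTo p (qp p) (-sum₁ p (altInvPow p 1) / 2) := by
  have h : qp p = (∑ k ∈ Ico 1 p, ((p - 1).choose (k - 1) : ℚ) / k) / 2 := by
    rw [← two_mul_qp]
    ring
  rw [h]
  refine ReducesTo.div ?_ (ReducesTo.ofNat 2) (two_ne_zero_of_ne_two hp)
  rw [sum₁, ← sum_neg_distrib]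
  refine ReducesTo.sum fun k hk => ?_
  have hk' := mem_Ico.1 hk
  have hr := (ReducesTo.natCast (p := p) ((p - 1).choose (k - 1))).div (ReducesTo.natCast k)
    (natCast_ne_zero_of_mem_Ico hk)
  rw [choose_pred_prime (by omega)] at hr
  convert hr using 1
  rw [altInvPow, pow_one, div_eq_mul_inv]
  obtain ⟨l, rfl⟩ : ∃ l, k = l + 1 := ⟨k - 1, by omega⟩
  rw [Nat.add_sub_cancel, pow_succ]
  ring

end Modular

/-- Weight four, depth two congruences:
    `H(1,-3) ≡ (1/2)H(-2,2) ≡ ∑_{k=0}^{p-3} 2^k B_k B_{p-3-k}` and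
    `H(-1,3) ≡ -(1/2) q_p B_{p-3}` modulo `p`. -/
theorem weight_four_depth_two (p : ℕ) (hp : p.Prime) (hp7 : 7 ≤ p) :
    pcong p (H [1, -3] (p - 1)) ((1 / 2) * H [-2, 2] (p - 1)) ∧
    pcong p ((1 / 2) * H [-2, 2] (p - 1))
      (∑ k ∈ Finset.range (p - 2), 2 ^ k * bernoulli k * bernoulli (p - 3 - k)) ∧
    pcong p (H [-1, 3] (p - 1)) (-(1 / 2) * qp p * bernoulli (p - 3)) := by
  have : Fact p.Prime := ⟨hp⟩
  have h2 := two_ne_zero_of_ne_two (p := p) (by omega)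
  have hhalf : ReducesTo p (1 / 2) (1 / 2) := ReducesTo.one.div (ReducesTo.ofNat 2) h2
  have hu : ∀ a, (fun i : ℕ => (1 : ZMod p) ^ i * (i : ZMod p)⁻¹ ^ a) = invPow p a := fun a => by
    ext i
    simp [invPow]
  have hv : ∀ a, (fun i : ℕ => (-1 : ZMod p) ^ i * (i : ZMod p)⁻¹ ^ a) = altInvPow p a :=
    fun a => rfl
  have hA : ReducesTo p (H [1, -3] (p - 1)) (sum₂ p (invPow p 1) (altInvPow p 3)) := by
    rw [← hu, ← hv]
    exact reducesTo_H 1 (-3)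
  have hC : ReducesTo p ((1 / 2) * H [-2, 2] (p - 1)) (sum₂ p (invPow p 1) (altInvPow p 3)) := by
    have h : ReducesTo p (H [-2, 2] (p - 1)) (sum₂ p (altInvPow p 2) (invPow p 2)) := by
      rw [← hu, ← hv]
      exact reducesTo_H (-2) 2
    rw [sum₂_altInvPow_two_invPow_two (by omega) (by omega)] at h
    have h' := hhalf.mul h
    rwa [← mul_assoc, one_div_mul_cancel h2, one_mul] at h'
  have hS : ReducesTo p
      (∑ k ∈ Finset.range (p - 2), 2 ^ k * bernoulli k * bernoulli (p - 3 - k))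
      (sum₂ p (invPow p 1) (altInvPow p 3)) := by
    rw [sum₂_invPow_one_altInvPow_three hp7]
    refine ReducesTo.sum fun k hk => ?_
    have hk := mem_range.1 hk
    exact (((ReducesTo.ofNat 2).pow k).mul (reducesTo_bernoulli (by omega))).mul
      (reducesTo_bernoulli (by omega))
  have hD : ReducesTo p (H [-1, 3] (p - 1)) (sum₂ p (altInvPow p 1) (invPow p 3)) := by
    rw [← hu, ← hv]
    exact reducesTo_H (-1) 3
  have hR : ReducesTo p (-(1 / 2) * qp p * bernoulli (p - 3))
      (sum₂ p (altInvPow p 1) (invPow p 3)) := by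
    have h := (hhalf.neg.mul (reducesTo_qp (p := p) (by omega))).mul
      (reducesTo_bernoulli (p := p) (n := p - 3) (by omega))
    convert h using 1
    have e1 := (sum₂_altInvPow_one_invPow_three (p := p) (by omega) (by omega)).1
    have e2 := two_mul_sum₁_altInvPow_three hp7
    field_simp
    linear_combination 2 * e1 - sum₁ p (altInvPow p 1) * e2
  exact ⟨hA.pcong hC, hC.pcong hS, hD.pcong hR⟩
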